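/- There exist R>0 and C>0 such that every optimal trajectory on [0,T] steering X₀=(0,0,π/2,0) to X₁=(x₁,y₁,θ₁,0) with |(x₁,y₁)| ≥ R, equipped with PMP adjoint data (ρ, φ̂, p₃, p₄), satisfies ‖(κ,p₃,p₄)‖_{L^∞([0,T])} ≤ C and ‖u‖_{L^∞([0,T])} ≤ C. -/

import Mathlib

open MeasureTheory Real Set

noncomputable section

/-- Distance between two angles, computed modulo `2π`, with values in `[0, π]`. -/
def angleDist (a b : ℝ) : ℝ := ‖((a - b : ℝ) : Real.Angle)‖

/-- Hypothesis (H1): `φ` and `ψ` are nonnegative, `C²`, even, nondecreasing on `[0,∞)`,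
and vanish at `0`. -/
def H1 (φ ψ : ℝ → ℝ) : Prop :=
  (∀ r, 0 ≤ φ r) ∧ (∀ r, 0 ≤ ψ r) ∧
  ContDiff ℝ 2 φ ∧ ContDiff ℝ 2 ψ ∧
  (∀ r, φ (-r) = φ r) ∧ (∀ r, ψ (-r) = ψ r) ∧
  MonotoneOn φ (Set.Ici 0) ∧ MonotoneOn ψ (Set.Ici 0) ∧
  φ 0 = 0 ∧ ψ 0 = 0

/-- Hypothesis (H2): `ψ` is strictly convex with `ψ''(0) > 0`. -/
def H2 (ψ : ℝ → ℝ) : Prop :=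
  StrictConvexOn ℝ Set.univ ψ ∧ 0 < iteratedDeriv 2 ψ 0

/-- Hypothesis (H3): superlinear growth `ψ(r) ≥ C₀ |r|^p` for `|r| ≥ R₀`. -/
def H3 (ψ : ℝ → ℝ) (p C₀ R₀ : ℝ) : Prop :=
  1 < p ∧ 0 < C₀ ∧ 0 < R₀ ∧ ∀ r : ℝ, R₀ ≤ |r| → C₀ * |r| ^ p ≤ ψ r

/-- An admissible trajectory of the control system `x' = cos θ`, `y' = sin θ`,
`θ' = κ`, `κ' = u` on `[0, T]` steering `W₀` to `W₁`, with control `u ∈ L^p`;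
the final angle is prescribed modulo `2π`. -/
def Connects (p : ℝ) (x y θ κ u : ℝ → ℝ) (T : ℝ)
    (W₀ W₁ : ℝ × ℝ × ℝ × ℝ) : Prop :=
  0 < T ∧ Measurable u ∧
  IntegrableOn (fun t => |u t| ^ p) (Set.Icc 0 T) ∧
  x 0 = W₀.1 ∧ y 0 = W₀.2.1 ∧ θ 0 = W₀.2.2.1 ∧ κ 0 = W₀.2.2.2 ∧
  (∀ t ∈ Set.Icc (0:ℝ) T, x t = x 0 + ∫ s in (0:ℝ)..t, Real.cos (θ s)) ∧
  (∀ t ∈ Set.Icc (0:ℝ) T, y t = y 0 + ∫ s in (0:ℝ)..t, Real.sin (θ s)) ∧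
  (∀ t ∈ Set.Icc (0:ℝ) T, θ t = θ 0 + ∫ s in (0:ℝ)..t, κ s) ∧
  (∀ t ∈ Set.Icc (0:ℝ) T, κ t = κ 0 + ∫ s in (0:ℝ)..t, u s) ∧
  x T = W₁.1 ∧ y T = W₁.2.1 ∧ (∃ k : ℤ, θ T = W₁.2.2.1 + 2 * π * (k : ℝ)) ∧
  κ T = W₁.2.2.2

/-- The cost `C(u,T) = ∫₀ᵀ (1 + φ(κ(t)) + ψ(u(t))) dt`. -/
def cost (φ ψ κ u : ℝ → ℝ) (T : ℝ) : ℝ :=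
  ∫ t in (0:ℝ)..T, (1 + φ (κ t) + ψ (u t))

/-- Optimality: the trajectory is admissible and minimizes the cost among all
admissible trajectories steering `W₀` to `W₁`, over all final times. -/
def IsOptimal (φ ψ : ℝ → ℝ) (p : ℝ) (x y θ κ u : ℝ → ℝ) (T : ℝ)
    (W₀ W₁ : ℝ × ℝ × ℝ × ℝ) : Prop :=
  Connects p x y θ κ u T W₀ W₁ ∧
  ∀ x' y' θ' κ' u' : ℝ → ℝ, ∀ T' : ℝ, Connects p x' y' θ' κ' u' T' W₀ W₁ →
    cost φ ψ κ u T ≤ cost φ ψ κ' u' T'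

/-- The initial point `X₀ = (0, 0, π/2, 0)`. -/
def Xinit : ℝ × ℝ × ℝ × ℝ := (0, 0, π/2, 0)

/-- The constant `C_{φ,ψ} = 8√π (2 + ψ(1) + sup_{s∈[0,√(5π)]} φ(s))`. -/
def Cconst (φ ψ : ℝ → ℝ) : ℝ :=
  8 * Real.sqrt π * (2 + ψ 1 + sSup (φ '' Set.Icc 0 (Real.sqrt (5*π))))

/-- PMP adjoint data `(ρ, φ̂, p₃, p₄)` along a trajectory. -/
def PMPData (φ ψ : ℝ → ℝ) (θ κ u : ℝ → ℝ) (T ρ φh : ℝ) (p₃ p₄ : ℝ → ℝ) : Prop :=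
  0 < ρ ∧ φh ∈ Set.Ico 0 (2*π) ∧
  (∀ t ∈ Set.Icc (0:ℝ) T, p₃ t = p₃ 0 + ∫ s in (0:ℝ)..t, ρ * Real.sin (θ s - φh)) ∧
  (∀ t ∈ Set.Icc (0:ℝ) T, p₄ t = p₄ 0 + ∫ s in (0:ℝ)..t, (-(p₃ s) + deriv φ (κ s))) ∧
  (∀ᵐ t ∂(volume.restrict (Set.Icc (0:ℝ) T)), deriv ψ (u t) = p₄ t) ∧
  (∀ᵐ t ∂(volume.restrict (Set.Icc (0:ℝ) T)),
    ρ * Real.cos (θ t - φh) + p₃ t * κ t + p₄ t * u t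
      - (1 + φ (κ t) + ψ (u t)) = 0)

/-- A primitive of a continuous function on `[0, T]` is differentiable there. -/
lemma hasDerivWithinAt_of_eq_integral {F f : ℝ → ℝ} {T : ℝ}
    (hf : ContinuousOn f (Icc 0 T))
    (hF : ∀ t ∈ Icc (0:ℝ) T, F t = F 0 + ∫ s in (0:ℝ)..t, f s) :
    ∀ t ∈ Icc (0:ℝ) T, HasDerivWithinAt F (f t) (Icc 0 T) t := by
  intro t ht
  have hint : IntervalIntegrable f volume 0 t := by
    apply ContinuousOn.intervalIntegrable
    rw [uIcc_of_le ht.1]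
    exact hf.mono (Icc_subset_Icc_right ht.2)
  have : Fact (t ∈ Icc (0:ℝ) T) := ⟨ht⟩
  have h := intervalIntegral.integral_hasDerivWithinAt_right (s := Icc 0 T) (t := Icc 0 T) hint
    (hf.stronglyMeasurableAtFilter_nhdsWithin measurableSet_Icc t) (hf t ht)
  exact (h.const_add (F 0)).congr (fun s hs => hF s hs) (hF t ht)

lemma continuousOn_of_eq_integral {F f : ℝ → ℝ} {T : ℝ} (hT : 0 ≤ T)
    (hf : IntegrableOn f (Icc 0 T))
    (hF : ∀ t ∈ Icc (0:ℝ) T, F t = F 0 + ∫ s in (0:ℝ)..t, f s) :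
    ContinuousOn F (Icc 0 T) := by
  have h := intervalIntegral.continuousOn_primitive_interval (a := (0:ℝ)) (b := T) (f := f)
    (μ := volume) (by rwa [uIcc_of_le hT])
  rw [uIcc_of_le hT] at h
  exact (continuousOn_const.add h).congr (fun s hs => hF s hs)

/-- Mean value theorem on a subinterval of `[0, T]` for functions with a one-sided derivative
at the endpoints. -/
lemma exists_deriv_eq_slope_of_hasDerivWithinAt {F f : ℝ → ℝ} {T a b : ℝ}
    (hF : ∀ t ∈ Icc (0:ℝ) T, HasDerivWithinAt F (f t) (Icc 0 T) t)
    (ha : 0 ≤ a) (hab : a < b) (hb : b ≤ T) :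
    ∃ c ∈ Ioo a b, f c = (F b - F a) / (b - a) := by
  have hsub : Icc a b ⊆ Icc 0 T := Icc_subset_Icc ha hb
  refine exists_hasDerivAt_eq_slope F f hab
    (fun t ht => ((hF t (hsub ht)).mono hsub).continuousWithinAt) fun t ht => ?_
  exact (hF t (hsub (Ioo_subset_Icc_self ht))).hasDerivAt
    (Icc_mem_nhds (ha.trans_lt ht.1) (ht.2.trans_le hb))

lemma abs_sub_le_of_hasDerivWithinAt {F f : ℝ → ℝ} {T B a b : ℝ}
    (hF : ∀ t ∈ Icc (0:ℝ) T, HasDerivWithinAt F (f t) (Icc 0 T) t)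
    (hB : ∀ t ∈ Icc (0:ℝ) T, |f t| ≤ B) (ha : a ∈ Icc (0:ℝ) T) (hb : b ∈ Icc (0:ℝ) T) :
    |F b - F a| ≤ B * |b - a| := by
  simpa only [Real.norm_eq_abs] using
    Convex.norm_image_sub_le_of_norm_hasDerivWithin_le hF (by simpa using hB) (convex_Icc 0 T) ha hb

/-- A superlinear function dominates `|r|` up to a constant. -/
lemma exists_abs_le_add_const {ψ : ℝ → ℝ} {p C₀ R₀ : ℝ} (hψ : ∀ r, 0 ≤ ψ r)
    (h3 : H3 ψ p C₀ R₀) (A : ℝ) (hA : 0 ≤ A) : ∃ c ≥ 0, ∀ r, A * |r| ≤ ψ r + c := by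
  obtain ⟨hp, hC, hR, h⟩ := h3
  obtain ⟨B, hB⟩ := Filter.eventually_atTop.1
    ((tendsto_rpow_atTop (sub_pos.2 hp)).eventually_ge_atTop (A / C₀))
  refine ⟨A * (max R₀ (max B 1)), by positivity, fun r => ?_⟩
  rcases le_or_gt |r| (max R₀ (max B 1)) with hr | hr
  · nlinarith [hψ r]
  · have h1 : R₀ ≤ |r| := (le_max_left _ _).trans hr.le
    have h2 : B ≤ |r| := ((le_max_left _ _).trans (le_max_right _ _)).trans hr.le
    have hpos : 0 < |r| := hR.trans_le h1
    have h4 := hB _ h2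
    have h5 : |r| ^ p = |r| ^ (p - 1) * |r| := by
      rw [← rpow_add_one hpos.ne']; ring_nf
    have h6 : A ≤ C₀ * |r| ^ (p - 1) := by
      rw [div_le_iff₀ hC] at h4; linarith
    have h7 := h r h1
    rw [h5] at h7
    have : A * |r| ≤ C₀ * |r| ^ (p - 1) * |r| := by gcongr
    have : 0 ≤ A * (max R₀ (max B 1)) := by positivity
    nlinarith

lemma even_monotone_le_of_abs_le {φ : ℝ → ℝ} (heven : ∀ r, φ (-r) = φ r)
    (hmono : MonotoneOn φ (Ici 0))
    {r B : ℝ} (h : |r| ≤ B) : φ r ≤ φ B := by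
  have hr : φ r = φ |r| := by
    rcases abs_choice r with h | h <;> rw [h]
    rw [heven]
  rw [hr]
  exact hmono (abs_nonneg r) ((abs_nonneg r).trans h) h

/-- The derivative of a strictly convex superlinear even function is a homeomorphism
of the line. -/
lemma exists_continuous_inverse_deriv {φ ψ : ℝ → ℝ} {p C₀ R₀ : ℝ}
    (h1 : H1 φ ψ) (h2 : H2 ψ) (h3 : H3 ψ p C₀ R₀) :
    ∃ g : ℝ → ℝ, Continuous g ∧ (∀ r, deriv ψ (g r) = r) ∧ ∀ r, g (deriv ψ r) = r := by
  obtain ⟨-, hψ0, -, hψ2, -, heven, -, -, -, hψz⟩ := h1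
  have hdiff : Differentiable ℝ ψ := hψ2.differentiable (by norm_num)
  have hcont : Continuous (deriv ψ) := hψ2.continuous_deriv (by norm_num)
  have hmono : StrictMono (deriv ψ) := by
    rw [← strictMonoOn_univ]
    exact h2.1.strictMonoOn_deriv fun x _ => hdiff x
  have hodd : ∀ r, deriv ψ (-r) = - deriv ψ r := by
    intro r
    have h : (fun x => ψ (-x)) = ψ := funext heven
    have h' := deriv_comp_neg ψ r
    rw [h] at h'
    linarith
  have htop : Filter.Tendsto (deriv ψ) Filter.atTop Filter.atTop := by
    rw [Filter.tendsto_atTop]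
    intro b
    obtain ⟨c, hc, hb⟩ := exists_abs_le_add_const hψ0 h3 (|b| + 1) (by positivity)
    filter_upwards [Filter.eventually_ge_atTop (c + 1)] with r hr
    have hr0 : 0 < r := by linarith
    have hs := h2.1.convexOn.slope_le_deriv (mem_univ 0) (mem_univ r) hr0 (hdiff r)
    rw [slope_def_field, hψz, sub_zero, sub_zero, div_le_iff₀ hr0] at hs
    have hb' := hb r
    rw [abs_of_pos hr0] at hb'
    have : |b| ≤ deriv ψ r := by
      by_contra hlt
      push Not at hlt
      nlinarith
    exact (le_abs_self b).trans this
  have hbot : Filter.Tendsto (deriv ψ) Filter.atBot Filter.atBot := by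
    have h : deriv ψ = fun r => - deriv ψ (-r) := funext fun r => by rw [hodd, neg_neg]
    rw [h]
    exact Filter.tendsto_neg_atTop_atBot.comp (htop.comp Filter.tendsto_neg_atBot_atTop)
  let e := hmono.orderIsoOfSurjective _ (hcont.surjective htop hbot)
  refine ⟨e.symm, e.symm.continuous, fun r => ?_, fun r => ?_⟩
  · exact e.apply_symm_apply r
  · exact e.symm_apply_apply r

/-- If the total amount of control is controlled and the direction stays close to `α` in the mean,
then the curvature is bounded. -/
lemma abs_curvature_le {θ κ v : ℝ → ℝ} {T K c α : ℝ} (hK : 0 ≤ K) (hc : 0 ≤ c)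
    (hθ : ∀ t ∈ Icc (0:ℝ) T, HasDerivWithinAt θ (κ t) (Icc 0 T) t)
    (hκ : ∀ t ∈ Icc (0:ℝ) T, HasDerivWithinAt κ (v t) (Icc 0 T) t)
    (hv : ContinuousOn v (Icc 0 T)) (hκ0 : κ 0 = 0)
    (hcost : ∀ a b, 0 ≤ a → a ≤ b → b ≤ T → ∫ s in a..b, |v s| ≤ K + c * (b - a))
    (hdir : T - ∫ s in (0:ℝ)..T, cos (θ s - α) ≤ K) :
    ∀ t ∈ Icc (0:ℝ) T, |κ t| ≤ 2 * (K + c * (K + 2)) + 4 := by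
  have hosc : ∀ a b, 0 ≤ a → a ≤ b → b ≤ T → |κ b - κ a| ≤ K + c * (b - a) := by
    intro a b ha hab hb
    have hsub : Icc a b ⊆ Icc 0 T := Icc_subset_Icc ha hb
    have hvi : IntervalIntegrable v volume a b := by
      apply ContinuousOn.intervalIntegrable
      rw [uIcc_of_le hab]; exact hv.mono hsub
    rw [← intervalIntegral.integral_eq_sub_of_hasDerivAt_of_le hab
      (fun t ht => ((hκ t (hsub ht)).mono hsub).continuousWithinAt)
      (fun t ht => (hκ t (hsub (Ioo_subset_Icc_self ht))).hasDerivAt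
        (Icc_mem_nhds (ha.trans_lt ht.1) (ht.2.trans_le hb))) hvi]
    exact (intervalIntegral.abs_integral_le_integral_abs hab).trans (hcost a b ha hab hb)
  intro t ht
  by_contra hlt
  push Not at hlt
  set L := K + 2 with hL
  set Q := K + c * L with hQ
  have hQ0 : 0 ≤ Q := by positivity
  have htL : L < t := by
    by_contra hle
    push Not at hle
    have h := hosc 0 t le_rfl ht.1 ht.2
    rw [hκ0, sub_zero, sub_zero] at h
    nlinarith
  have ha0 : 0 ≤ t - L := by linarith
  have hat : t - L ≤ t := by linarith
  have hsub : Icc (t - L) t ⊆ Icc 0 T := Icc_subset_Icc ha0 ht.2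
  have hbig : ∀ s ∈ Icc (t - L) t, Q + 4 ≤ |κ s| := by
    intro s hs
    have h := hosc s t (ha0.trans hs.1) hs.2 ht.2
    have h' : c * (t - s) ≤ c * L := mul_le_mul_of_nonneg_left (by linarith [hs.1]) hc
    have := abs_sub_abs_le_abs_sub (κ t) (κ s)
    linarith
  have hne : ∀ s ∈ Icc (t - L) t, κ s ≠ 0 := fun s hs h => by
    have := hbig s hs
    rw [h, abs_zero] at this
    linarith
  have hθc : ContinuousOn θ (Icc 0 T) := fun s hs => (hθ s hs).continuousWithinAt
  have hκc : ContinuousOn κ (Icc 0 T) := fun s hs => (hκ s hs).continuousWithinAt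
  have hcosc : ContinuousOn (fun s => cos (θ s - α)) (Icc 0 T) :=
    continuous_cos.comp_continuousOn (hθc.sub continuousOn_const)
  have hsinc : ContinuousOn (fun s => sin (θ s - α)) (Icc 0 T) :=
    continuous_sin.comp_continuousOn (hθc.sub continuousOn_const)
  have hquot : ContinuousOn (fun s => sin (θ s - α) * v s / κ s ^ 2) (Icc (t - L) t) :=
    ((hsinc.mul hv).mono hsub).div ((hκc.mono hsub).pow 2) fun s hs => pow_ne_zero 2 (hne s hs)
  have hquoti : IntervalIntegrable (fun s => sin (θ s - α) * v s / κ s ^ 2) volume (t - L) t :=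
    ContinuousOn.intervalIntegrable (by rwa [uIcc_of_le hat])
  have hcosi : IntervalIntegrable (fun s => cos (θ s - α)) volume (t - L) t :=
    ContinuousOn.intervalIntegrable (by rw [uIcc_of_le hat]; exact hcosc.mono hsub)
  have hFTC := intervalIntegral.integral_eq_sub_of_hasDerivAt_of_le
    (f := fun s => sin (θ s - α) / κ s)
    (f' := fun s => cos (θ s - α) - sin (θ s - α) * v s / κ s ^ 2) hat
    ((hsinc.mono hsub).div (hκc.mono hsub) hne)
    (fun s hs => by
      have hs' := Ioo_subset_Icc_self hs
      have hnhds : Icc 0 T ∈ nhds s := Icc_mem_nhds (ha0.trans_lt hs.1) (hs.2.trans_le ht.2)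
      have d1 := (hθ s (hsub hs')).hasDerivAt hnhds
      have d2 := (hκ s (hsub hs')).hasDerivAt hnhds
      refine ((d1.sub_const α).sin.div d2 (hne s hs')).congr_deriv ?_
      have := hne s hs'
      field_simp) (hcosi.sub hquoti)
  rw [intervalIntegral.integral_sub hcosi hquoti] at hFTC
  have hend : ∀ s ∈ Icc (t - L) t, |sin (θ s - α) / κ s| ≤ 1 / 4 := by
    intro s hs
    rw [abs_div]
    have := hbig s hs
    have := abs_sin_le_one (θ s - α)
    rw [div_le_iff₀ (by linarith)]
    linarith
  have hrem : |∫ s in (t - L)..t, sin (θ s - α) * v s / κ s ^ 2| ≤ 1 / 4 := by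
    have habsv : IntervalIntegrable (fun s => |v s| / (Q + 4) ^ 2) volume (t - L) t :=
      ContinuousOn.intervalIntegrable (by
        rw [uIcc_of_le hat]; exact ((hv.mono hsub).abs).div_const _)
    calc |∫ s in (t - L)..t, sin (θ s - α) * v s / κ s ^ 2|
        ≤ ∫ s in (t - L)..t, |sin (θ s - α) * v s / κ s ^ 2| :=
          intervalIntegral.abs_integral_le_integral_abs hat
      _ ≤ ∫ s in (t - L)..t, |v s| / (Q + 4) ^ 2 := by
          refine intervalIntegral.integral_mono_on hat hquoti.abs habsv fun s hs => ?_
          rw [abs_div, abs_mul, abs_pow]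
          have h1 := hbig s hs
          have h2 := abs_sin_le_one (θ s - α)
          gcongr
          nlinarith [abs_nonneg (v s)]
      _ = (∫ s in (t - L)..t, |v s|) / (Q + 4) ^ 2 := intervalIntegral.integral_div _ _
      _ ≤ Q / (Q + 4) ^ 2 := by
          have := hcost (t - L) t ha0 hat ht.2
          gcongr
          calc _ ≤ _ := this
            _ = Q := by rw [hQ]; ring
      _ ≤ 1 / 4 := by
          rw [div_le_div_iff₀ (by positivity) (by norm_num)]
          nlinarith
  have hcosle : ∫ s in (t - L)..t, cos (θ s - α) ≤ 1 := by
    have e1 := hend t (right_mem_Icc.2 hat)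
    have e2 := hend (t - L) (left_mem_Icc.2 hat)
    rw [abs_le] at e1 e2 hrem
    linarith [e1.2, e2.1, hrem.2]
  have hint : ∀ a b, 0 ≤ a → a ≤ b → b ≤ T →
      IntervalIntegrable (fun s => cos (θ s - α)) volume a b := fun a b ha hab hb =>
    ContinuousOn.intervalIntegrable
      (by rw [uIcc_of_le hab]; exact hcosc.mono (Icc_subset_Icc ha hb))
  have hle : ∀ a b, 0 ≤ a → a ≤ b → b ≤ T → ∫ s in a..b, cos (θ s - α) ≤ b - a := by
    intro a b ha hab hb
    calc _ ≤ ∫ s in a..b, (1:ℝ) := intervalIntegral.integral_mono_on hab (hint a b ha hab hb)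
          intervalIntegrable_const fun s _ => cos_le_one _
      _ = b - a := by simp
  have s1 := intervalIntegral.integral_add_adjacent_intervals
    (hint 0 (t - L) le_rfl ha0 (hat.trans ht.2)) hcosi
  have s2 := intervalIntegral.integral_add_adjacent_intervals
    (hint 0 t le_rfl ht.1 ht.2) (hint t T ht.1 ht.2 le_rfl)
  have := hle 0 (t - L) le_rfl ha0 (hat.trans ht.2)
  have := hle t T ht.1 ht.2 le_rfl
  linarith

set_option maxHeartbeats 1000000 in
/-- Local estimates for the extremal equations: on a time interval of length at least `1`, a bound
on the curvature yields bounds on the adjoint variables. -/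
lemma exists_adjoint_bound {φ ψ g : ℝ → ℝ} (h1 : H1 φ ψ) (hg : Continuous g)
    (hgr : ∀ r, deriv ψ (g r) = r) (M : ℝ) (hM : 0 ≤ M) :
    ∃ C ≥ 0, ∀ (θ κ p₃ p₄ : ℝ → ℝ) (T ρ φh : ℝ), 1 ≤ T → 0 < ρ →
      (∀ t ∈ Icc (0:ℝ) T, |κ t| ≤ M) →
      (∀ t ∈ Icc (0:ℝ) T, HasDerivWithinAt θ (κ t) (Icc 0 T) t) →
      (∀ t ∈ Icc (0:ℝ) T, HasDerivWithinAt κ (g (p₄ t)) (Icc 0 T) t) →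
      (∀ t ∈ Icc (0:ℝ) T, HasDerivWithinAt p₃ (ρ * sin (θ t - φh)) (Icc 0 T) t) →
      (∀ t ∈ Icc (0:ℝ) T, HasDerivWithinAt p₄ (-(p₃ t) + deriv φ (κ t)) (Icc 0 T) t) →
      (∀ t ∈ Icc (0:ℝ) T, ρ * cos (θ t - φh) + p₃ t * κ t + p₄ t * g (p₄ t)
        - (1 + φ (κ t) + ψ (g (p₄ t))) = 0) →
      ∀ t ∈ Icc (0:ℝ) T, |p₃ t| ≤ C ∧ |p₄ t| ≤ C ∧ |g (p₄ t)| ≤ C := by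
  obtain ⟨hφ0, hψ0, hφ2, hψ2, hφe, hψe, hφm, hψm, -, -⟩ := h1
  have hdφ : Continuous (deriv φ) := hφ2.continuous_deriv (by norm_num)
  have hdψ : Continuous (deriv ψ) := hψ2.continuous_deriv (by norm_num)
  set ε : ℝ := 1 / (36 * (M + 1)) with hε
  have hεpos : 0 < ε := by positivity
  have hεM : ε * M ≤ 1 / 36 := by
    rw [hε, div_mul_eq_mul_div, div_le_div_iff₀ (by positivity) (by norm_num)]
    nlinarith
  have hε1 : 9 * ε ≤ 1 := by
    rw [hε, mul_one_div, div_le_one (by positivity)]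
    nlinarith
  set U : ℝ := 2 * M / ε with hU
  have hU0 : 0 ≤ U := by positivity
  have hbdd : ∀ (f : ℝ → ℝ) (_ : Continuous f) (B : ℝ), ∃ C ≥ 0, ∀ r, |r| ≤ B → |f r| ≤ C := by
    intro f hf B
    obtain ⟨C, hC⟩ :=
      (isCompact_Icc (a := -B) (b := B)).exists_bound_of_continuousOn hf.continuousOn
    exact ⟨max C 0, le_max_right _ _, fun r hr => (hC r (abs_le.1 hr)).trans (le_max_left _ _)⟩
  obtain ⟨P₀, hP₀, hPψ⟩ := hbdd _ hdψ U
  obtain ⟨D, hD, hDφ⟩ := hbdd _ hdφ M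
  set P₁ : ℝ := 2 * P₀ / ε + D with hP₁
  have hP₁0 : 0 ≤ P₁ := by positivity
  set A : ℝ := 1 + φ M + ψ U + P₀ * U + P₁ * M + 2 * P₁ / ε with hA
  have hA0 : 0 ≤ A := by have := hφ0 M; have := hψ0 U; positivity
  set C₃ : ℝ := P₁ + 2 * A with hC₃
  set C₄ : ℝ := P₀ + C₃ + D with hC₄
  obtain ⟨G, hG, hgG⟩ := hbdd _ hg C₄
  have hC₃0 : 0 ≤ C₃ := by positivity
  have hC₄0 : 0 ≤ C₄ := by positivity
  refine ⟨C₃ + C₄ + G, by positivity, ?_⟩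
  intro θ κ p₃ p₄ T ρ φh hT hρ hκM hθ hκ hp₃ hp₄ hham
  -- small values of `p₄` on intervals of length `ε`
  have small₄ : ∀ a, 0 ≤ a → a + ε ≤ T →
      ∃ t ∈ Ioo a (a + ε), |p₄ t| ≤ P₀ ∧ |g (p₄ t)| ≤ U := by
    intro a ha hb
    obtain ⟨t, ht, hval⟩ := exists_deriv_eq_slope_of_hasDerivWithinAt hκ ha
      (by linarith : a < a + ε) hb
    have hUb : |g (p₄ t)| ≤ U := by
      rw [hval, abs_div, add_sub_cancel_left, abs_of_pos hεpos, hU]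
      gcongr
      have e1 := hκM a ⟨ha, by linarith⟩
      have e2 := hκM (a + ε) ⟨by linarith, hb⟩
      calc _ ≤ |κ (a + ε)| + |κ a| := abs_sub _ _
        _ ≤ 2 * M := by linarith
    refine ⟨t, ht, ?_, hUb⟩
    have := hPψ _ hUb
    rwa [hgr] at this
  have small₃ : ∀ a, 0 ≤ a → a + 3 * ε ≤ T → ∃ t ∈ Ioo a (a + 3 * ε), |p₃ t| ≤ P₁ := by
    intro a ha hb
    obtain ⟨t₁, ht₁, hv₁, -⟩ := small₄ a ha (by linarith)
    obtain ⟨t₂, ht₂, hv₂, -⟩ := small₄ (a + 2 * ε) (by linarith) (by linarith)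
    have hgap : ε ≤ t₂ - t₁ := by linarith [ht₁.2, ht₂.1]
    obtain ⟨t, ht, hval⟩ := exists_deriv_eq_slope_of_hasDerivWithinAt hp₄
      (ha.trans ht₁.1.le) (by linarith : t₁ < t₂) (by linarith [ht₂.2])
    have hmem : t ∈ Ioo a (a + 3 * ε) := ⟨ht₁.1.trans ht.1, by linarith [ht.2, ht₂.2]⟩
    refine ⟨t, hmem, ?_⟩
    have hd := hDφ _ (hκM t ⟨ha.trans hmem.1.le, by linarith [hmem.2]⟩)
    have hs : |(p₄ t₂ - p₄ t₁) / (t₂ - t₁)| ≤ 2 * P₀ / ε := by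
      rw [abs_div, abs_of_pos (hεpos.trans_le hgap)]
      gcongr
      calc _ ≤ |p₄ t₂| + |p₄ t₁| := abs_sub _ _
        _ ≤ 2 * P₀ := by linarith
    have : p₃ t = deriv φ (κ t) - (p₄ t₂ - p₄ t₁) / (t₂ - t₁) := by linarith
    rw [this]
    calc _ ≤ _ := abs_sub _ _
      _ ≤ P₁ := by linarith
  have lip₃ : ∀ a ∈ Icc (0:ℝ) T, ∀ b ∈ Icc (0:ℝ) T, |p₃ b - p₃ a| ≤ ρ * |b - a| := by
    intro a ha b hb
    refine abs_sub_le_of_hasDerivWithinAt hp₃ (fun t _ => ?_) ha hb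
    rw [abs_mul, abs_of_pos hρ]
    exact mul_le_of_le_one_right hρ.le (abs_sin_le_one _)
  -- bound on `ρ`
  have hρA : ρ ≤ 2 * A := by
    obtain ⟨t₁, ht₁, hv₁⟩ := small₃ 0 le_rfl (by linarith)
    obtain ⟨t₂, ht₂, hv₂⟩ := small₃ (6 * ε) (by linarith) (by linarith)
    obtain ⟨s, hs, hps, hgs⟩ := small₄ 0 le_rfl (by linarith)
    rw [zero_add] at ht₁ hs
    have hgap : ε ≤ t₂ - t₁ := by linarith [ht₁.2, ht₂.1]
    obtain ⟨t, ht, hval⟩ := exists_deriv_eq_slope_of_hasDerivWithinAt hp₃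
      ht₁.1.le (by linarith : t₁ < t₂) (by linarith [ht₂.2])
    have hsin : ρ * |sin (θ t - φh)| ≤ 2 * P₁ / ε := by
      rw [← abs_of_pos hρ, ← abs_mul, hval, abs_div,
        abs_of_pos (hεpos.trans_le hgap)]
      gcongr
      calc _ ≤ |p₃ t₂| + |p₃ t₁| := abs_sub _ _
        _ ≤ 2 * P₁ := by linarith
    have hsT : s ∈ Icc (0:ℝ) T := ⟨hs.1.le, by linarith [hs.2]⟩
    have htT : t ∈ Icc (0:ℝ) T := ⟨by linarith [ht.1, ht₁.1], by linarith [ht.2, ht₂.2]⟩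
    have hst : |s - t| ≤ 9 * ε := by
      rw [abs_le]; constructor <;> linarith [hs.1, hs.2, ht.1, ht.2, ht₁.1, ht₂.2]
    have hst₁ : |s - t₁| ≤ 3 * ε := by
      rw [abs_le]; constructor <;> linarith [hs.1, hs.2, ht₁.1, ht₁.2]
    have hθst : |θ s - θ t| ≤ 1 / 4 := by
      calc _ ≤ M * |s - t| := abs_sub_le_of_hasDerivWithinAt hθ hκM htT hsT
        _ ≤ M * (9 * ε) := by gcongr
        _ ≤ 1 / 4 := by linarith
    have hsins : |sin (θ s - φh)| ≤ |sin (θ t - φh)| + 1 / 4 := by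
      have e := Real.abs_sin_sub_sin_le (θ s - φh) (θ t - φh)
      rw [sub_sub_sub_cancel_right] at e
      have := abs_sub_abs_le_abs_sub (sin (θ s - φh)) (sin (θ t - φh))
      linarith
    have hp₃s : |p₃ s| ≤ P₁ + ρ * (3 * ε) := by
      have e := lip₃ t₁ ⟨ht₁.1.le, by linarith [ht₁.2]⟩ s hsT
      have e' : ρ * |s - t₁| ≤ ρ * (3 * ε) := by gcongr
      have := abs_sub_abs_le_abs_sub (p₃ s) (p₃ t₁)
      linarith
    have hcos : ρ * |cos (θ s - φh)| ≤
        (P₁ + ρ * (3 * ε)) * M + P₀ * U + (1 + φ M + ψ U) := by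
      have heq : ρ * cos (θ s - φh) =
          -(p₃ s * κ s) - p₄ s * g (p₄ s) + (1 + φ (κ s) + ψ (g (p₄ s))) := by
        linarith [hham s hsT]
      have k1 : |p₃ s * κ s| ≤ (P₁ + ρ * (3 * ε)) * M := by
        rw [abs_mul]
        have := hκM s hsT
        gcongr
      have k2 : |p₄ s * g (p₄ s)| ≤ P₀ * U := by
        rw [abs_mul]; gcongr
      have k3 := even_monotone_le_of_abs_le hφe hφm (hκM s hsT)
      have k4 := even_monotone_le_of_abs_le hψe hψm hgs
      have k5 := hφ0 (κ s)
      have k6 := hψ0 (g (p₄ s))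
      rw [← abs_of_pos hρ, ← abs_mul, abs_of_pos hρ, heq]
      rw [abs_le] at k1 k2 ⊢
      constructor <;> linarith [k1.1, k1.2, k2.1, k2.2]
    have hone : 1 ≤ |cos (θ s - φh)| + |sin (θ s - φh)| := by
      have e := sin_sq_add_cos_sq (θ s - φh)
      rw [← sq_abs, ← sq_abs (cos _)] at e
      nlinarith [abs_nonneg (cos (θ s - φh)), abs_nonneg (sin (θ s - φh))]
    have m1 : ρ ≤ ρ * |cos (θ s - φh)| + ρ * |sin (θ s - φh)| := by nlinarith
    have m2 : ρ * |sin (θ s - φh)| ≤ ρ * |sin (θ t - φh)| + ρ * (1 / 4) := by nlinarith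
    have m3 : ρ * (ε * M) ≤ ρ * (1 / 36) := by gcongr
    have m4 : (P₁ + ρ * (3 * ε)) * M = P₁ * M + 3 * (ρ * (ε * M)) := by ring
    linarith
  -- the bounds on `p₃` and `p₄` propagate from the good times
  have window : ∀ t ∈ Icc (0:ℝ) T, ∃ a, 0 ≤ a ∧ a + 3 * ε ≤ T ∧ a ≤ t ∧ t ≤ a + 3 * ε := by
    intro t ht
    rcases le_total (t + 3 * ε) T with h | h
    · exact ⟨t, ht.1, h, le_rfl, by linarith⟩
    · exact ⟨T - 3 * ε, by linarith, by linarith, by linarith, by linarith [ht.2]⟩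
  have bound₃ : ∀ t ∈ Icc (0:ℝ) T, |p₃ t| ≤ C₃ := by
    intro t ht
    obtain ⟨a, ha, haT, hat, hta⟩ := window t ht
    obtain ⟨s, hs, hvs⟩ := small₃ a ha haT
    have e := lip₃ s ⟨ha.trans hs.1.le, hs.2.le.trans haT⟩ t ht
    have hst : |t - s| ≤ 1 := by
      rw [abs_le]; constructor <;> linarith [hs.1, hs.2]
    have e' : ρ * |t - s| ≤ 2 * A * 1 := by gcongr
    have := abs_sub_abs_le_abs_sub (p₃ t) (p₃ s)
    linarith
  have bound₄ : ∀ t ∈ Icc (0:ℝ) T, |p₄ t| ≤ C₄ := by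
    intro t ht
    obtain ⟨a, ha, haT, hat, hta⟩ := window t ht
    obtain ⟨s, hs, hvs, -⟩ := small₄ a ha (by linarith)
    have e := abs_sub_le_of_hasDerivWithinAt (B := C₃ + D) hp₄ (fun r hr => by
      have e1 := bound₃ r hr
      have e2 := hDφ _ (hκM r hr)
      calc _ ≤ |-(p₃ r)| + |deriv φ (κ r)| := abs_add_le _ _
        _ ≤ C₃ + D := by rw [abs_neg]; linarith)
      (⟨ha.trans hs.1.le, by linarith [hs.2]⟩ : s ∈ Icc (0:ℝ) T) ht
    have hst : |t - s| ≤ 1 := by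
      rw [abs_le]; constructor <;> linarith [hs.1, hs.2]
    have e' : (C₃ + D) * |t - s| ≤ (C₃ + D) * 1 := by gcongr
    have := abs_sub_abs_le_abs_sub (p₄ t) (p₄ s)
    linarith
  intro t ht
  have e3 := bound₃ t ht
  have e4 := bound₄ t ht
  have e5 := hgG _ e4
  exact ⟨by linarith, by linarith, by linarith⟩

/-- The straight segment of a turn–segment–turn path exists when the target is far. -/
lemma exists_segment_direction {dx dy : ℝ → ℝ} (hdx : Continuous dx) (hdy : Continuous dy)
    (hbx : ∀ α, |dx α| ≤ 2) (hby : ∀ α, |dy α| ≤ 2) {D α₀ : ℝ} (hD : 5 ≤ D) :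
    ∃ α ∈ Icc (α₀ - π / 2) (α₀ + π / 2), ∃ ℓ > 0, ℓ ≤ D + 4 ∧
      ℓ * cos α + dx α = D * cos α₀ ∧ ℓ * sin α + dy α = D * sin α₀ := by
  have hdot : ∀ α β, |dx α * cos β + dy α * sin β| ≤ 4 := by
    intro α β
    calc _ ≤ |dx α * cos β| + |dy α * sin β| := abs_add_le _ _
      _ ≤ 2 * 1 + 2 * 1 := by
        rw [abs_mul, abs_mul]
        have := hbx α; have := hby α
        have := abs_cos_le_one β; have := abs_sin_le_one β
        gcongr
      _ = 4 := by norm_num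
  obtain ⟨α, hα, hzero⟩ := intermediate_value_Icc
    (f := fun α => (D * cos α₀ - dx α) * sin α - (D * sin α₀ - dy α) * cos α)
    (by linarith [pi_pos] : α₀ - π / 2 ≤ α₀ + π / 2)
    (by fun_prop)
    (show (0:ℝ) ∈ _ by
      have e := sin_sq_add_cos_sq α₀
      have k1 := abs_le.1 (hdot (α₀ - π / 2) α₀)
      have k2 := abs_le.1 (hdot (α₀ + π / 2) α₀)
      constructor
      · simp only [sin_sub_pi_div_two, cos_sub_pi_div_two]
        nlinarith [k1.1, k1.2]
      · simp only [sin_add_pi_div_two, cos_add_pi_div_two]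
        nlinarith [k2.1, k2.2])
  simp only at hzero
  set ℓ := (D * cos α₀ - dx α) * cos α + (D * sin α₀ - dy α) * sin α with hℓ
  have e := sin_sq_add_cos_sq α
  have e₀ := sin_sq_add_cos_sq α₀
  have hx : ℓ * cos α = D * cos α₀ - dx α := by
    have : ℓ * cos α = (D * cos α₀ - dx α) * (sin α ^ 2 + cos α ^ 2)
      - sin α * ((D * cos α₀ - dx α) * sin α - (D * sin α₀ - dy α) * cos α) := by
      rw [hℓ]; ring
    rw [this, e, hzero]; ring
  have hy : ℓ * sin α = D * sin α₀ - dy α := by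
    have : ℓ * sin α = (D * sin α₀ - dy α) * (sin α ^ 2 + cos α ^ 2)
      + cos α * ((D * cos α₀ - dx α) * sin α - (D * sin α₀ - dy α) * cos α) := by
      rw [hℓ]; ring
    rw [this, e, hzero]; ring
  have hcos : 0 ≤ cos (α - α₀) :=
    cos_nonneg_of_mem_Icc ⟨by linarith [hα.1], by linarith [hα.2]⟩
  have hprod : ℓ * cos (α - α₀) = D - (dx α * cos α₀ + dy α * sin α₀) := by
    have : ℓ * cos (α - α₀) = (ℓ * cos α) * cos α₀ + (ℓ * sin α) * sin α₀ := by
      rw [cos_sub]; ring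
    rw [this, hx, hy]
    linear_combination D * e₀
  have k := abs_le.1 (hdot α α₀)
  have k' := abs_le.1 (hdot α α)
  refine ⟨α, hα, ℓ, ?_, ?_, by linarith, by linarith⟩
  · by_contra hle
    push Not at hle
    nlinarith [k.2, mul_nonneg (neg_nonneg.2 hle) hcos]
  · have : ℓ = D * cos (α - α₀) - (dx α * cos α + dy α * sin α) := by
      rw [hℓ, cos_sub]; ring
    rw [this]
    nlinarith [k'.1, cos_le_one (α - α₀)]

lemma contDiff_smoothTransition_deriv : ContDiff ℝ 1 (deriv smoothTransition) := by
  have h : ContDiff ℝ 2 smoothTransition := by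
    exact_mod_cast Real.smoothTransition.contDiff (n := 2)
  exact ((contDiff_succ_iff_deriv (n := 1)).1 (by simpa [one_add_one_eq_two] using h)).2.2

lemma deriv_smoothTransition_eq_zero {t : ℝ} (ht : t ∉ Ioo (0:ℝ) 1) :
    deriv smoothTransition t = 0 := by
  rw [mem_Ioo, not_and_or, not_lt, not_lt] at ht
  rcases ht with ht | ht
  · refine IsLocalMin.deriv_eq_zero (Filter.Eventually.of_forall fun s => ?_)
    rw [Real.smoothTransition.zero_of_nonpos ht]
    exact Real.smoothTransition.nonneg s
  · refine IsLocalMax.deriv_eq_zero (Filter.Eventually.of_forall fun s => ?_)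
    rw [Real.smoothTransition.one_of_one_le ht]
    exact Real.smoothTransition.le_one s

lemma deriv_deriv_smoothTransition_eq_zero {t : ℝ} (ht : t ∉ Ioo (0:ℝ) 1) :
    deriv (deriv smoothTransition) t = 0 := by
  refine IsLocalMin.deriv_eq_zero (Filter.Eventually.of_forall fun s => ?_)
  rw [deriv_smoothTransition_eq_zero ht]
  exact Real.smoothTransition.monotone.deriv_nonneg

/-- The heading along a path that turns from `π / 2` to `α`, goes straight for a length `ℓ`,
then turns from `α` to `β`. -/
def turnHeading (α β ℓ t : ℝ) : ℝ :=
  π / 2 + (α - π / 2) * smoothTransition t + (β - α) * smoothTransition (t - (1 + ℓ))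

def turnCurvature (α β ℓ t : ℝ) : ℝ :=
  (α - π / 2) * deriv smoothTransition t + (β - α) * deriv smoothTransition (t - (1 + ℓ))

def turnControl (α β ℓ t : ℝ) : ℝ :=
  (α - π / 2) * deriv (deriv smoothTransition) t +
    (β - α) * deriv (deriv smoothTransition) (t - (1 + ℓ))

lemma differentiable_smoothTransition : Differentiable ℝ smoothTransition :=
  (Real.smoothTransition.contDiff (n := 1)).differentiable (by norm_num)

lemma continuous_deriv_deriv_smoothTransition : Continuous (deriv (deriv smoothTransition)) :=
  contDiff_smoothTransition_deriv.continuous_deriv (by norm_num)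

lemma hasDerivAt_turnHeading (α β ℓ t : ℝ) :
    HasDerivAt (turnHeading α β ℓ) (turnCurvature α β ℓ t) t := by
  have h1 := (differentiable_smoothTransition t).hasDerivAt
  have h2 := (differentiable_smoothTransition (t - (1 + ℓ))).hasDerivAt.comp_sub_const t (1 + ℓ)
  exact ((h1.const_mul (α - π / 2)).const_add (π / 2)).add (h2.const_mul (β - α))

lemma hasDerivAt_turnCurvature (α β ℓ t : ℝ) :
    HasDerivAt (turnCurvature α β ℓ) (turnControl α β ℓ t) t := by
  have hd : Differentiable ℝ (deriv smoothTransition) :=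
    contDiff_smoothTransition_deriv.differentiable (by norm_num)
  have h1 := (hd t).hasDerivAt
  have h2 := (hd (t - (1 + ℓ))).hasDerivAt.comp_sub_const t (1 + ℓ)
  exact (h1.const_mul (α - π / 2)).add (h2.const_mul (β - α))

lemma continuous_turnControl (α β ℓ : ℝ) : Continuous (turnControl α β ℓ) := by
  have := continuous_deriv_deriv_smoothTransition
  unfold turnControl
  fun_prop

lemma continuous_turnHeading (α β ℓ : ℝ) : Continuous (turnHeading α β ℓ) :=
  continuous_iff_continuousAt.2 fun t => (hasDerivAt_turnHeading α β ℓ t).continuousAt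

lemma continuous_turnCurvature (α β ℓ : ℝ) : Continuous (turnCurvature α β ℓ) :=
  continuous_iff_continuousAt.2 fun t => (hasDerivAt_turnCurvature α β ℓ t).continuousAt

lemma integral_turnHeading (f : ℝ → ℝ) (hf : Continuous f) {α β ℓ : ℝ} (hℓ : 0 ≤ ℓ) :
    ∫ t in (0:ℝ)..(2 + ℓ), f (turnHeading α β ℓ t) =
      ℓ * f α + ((∫ t in (0:ℝ)..1, f (π / 2 + (α - π / 2) * smoothTransition t))
        + ∫ t in (0:ℝ)..1, f (α + (β - α) * smoothTransition t)) := by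
  have hc : Continuous fun t => f (turnHeading α β ℓ t) := hf.comp (continuous_turnHeading α β ℓ)
  have hi : ∀ a b, IntervalIntegrable (fun t => f (turnHeading α β ℓ t)) volume a b :=
    fun a b => hc.intervalIntegrable a b
  rw [← intervalIntegral.integral_add_adjacent_intervals (hi 0 1) (hi 1 (2 + ℓ)),
    ← intervalIntegral.integral_add_adjacent_intervals (hi 1 (1 + ℓ)) (hi (1 + ℓ) (2 + ℓ))]
  have i1 : ∫ t in (0:ℝ)..1, f (turnHeading α β ℓ t) =
      ∫ t in (0:ℝ)..1, f (π / 2 + (α - π / 2) * smoothTransition t) := by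
    refine intervalIntegral.integral_congr fun t ht => ?_
    rw [uIcc_of_le zero_le_one] at ht
    simp only [turnHeading]
    rw [Real.smoothTransition.zero_of_nonpos (by linarith [ht.2] : t - (1 + ℓ) ≤ 0)]
    ring_nf
  have i2 : ∫ t in (1:ℝ)..(1 + ℓ), f (turnHeading α β ℓ t) = ℓ * f α := by
    have : ∫ t in (1:ℝ)..(1 + ℓ), f (turnHeading α β ℓ t) = ∫ t in (1:ℝ)..(1 + ℓ), f α := by
      refine intervalIntegral.integral_congr fun t ht => ?_
      rw [uIcc_of_le (by linarith)] at ht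
      simp only [turnHeading]
      rw [Real.smoothTransition.zero_of_nonpos (by linarith [ht.2] : t - (1 + ℓ) ≤ 0),
        Real.smoothTransition.one_of_one_le ht.1]
      ring_nf
    rw [this, intervalIntegral.integral_const, smul_eq_mul]
    ring
  have i3 : ∫ t in (1 + ℓ)..(2 + ℓ), f (turnHeading α β ℓ t) =
      ∫ t in (0:ℝ)..1, f (α + (β - α) * smoothTransition t) := by
    have h := intervalIntegral.integral_comp_sub_right (a := 1 + ℓ) (b := 2 + ℓ)
      (fun t => f (α + (β - α) * smoothTransition t)) (1 + ℓ)
    rw [show 1 + ℓ - (1 + ℓ) = 0 by ring, show 2 + ℓ - (1 + ℓ) = 1 by ring] at h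
    rw [← h]
    refine intervalIntegral.integral_congr fun t ht => ?_
    rw [uIcc_of_le (by linarith)] at ht
    simp only [turnHeading]
    rw [Real.smoothTransition.one_of_one_le (by linarith [ht.1] : 1 ≤ t)]
    ring_nf
  rw [i1, i2, i3]
  ring

/-- Far targets can be reached at a cost exceeding their distance by at most a constant. -/
lemma exists_connects_cost_le {φ ψ : ℝ → ℝ} (h1 : H1 φ ψ) {p : ℝ} (hp : 0 < p) :
    ∃ K ≥ 0, ∀ x₁ y₁ θ₁ : ℝ, 5 ≤ Real.sqrt (x₁ ^ 2 + y₁ ^ 2) →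
      ∃ x y θ κ u : ℝ → ℝ, ∃ T, Connects p x y θ κ u T Xinit (x₁, y₁, θ₁, 0) ∧
        cost φ ψ κ u T ≤ Real.sqrt (x₁ ^ 2 + y₁ ^ 2) + K := by
  obtain ⟨hφ0, hψ0, hφ2, hψ2, hφe, hψe, hφm, hψm, hφz, hψz⟩ := h1
  have hd1 : Continuous (deriv smoothTransition) := contDiff_smoothTransition_deriv.continuous
  have hd2 := continuous_deriv_deriv_smoothTransition
  obtain ⟨B₁, hB₁⟩ := (isCompact_Icc (a := (0:ℝ)) (b := 1)).exists_bound_of_continuousOn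
    hd1.continuousOn
  obtain ⟨B₂, hB₂⟩ := (isCompact_Icc (a := (0:ℝ)) (b := 1)).exists_bound_of_continuousOn
    hd2.continuousOn
  have hB₁0 : 0 ≤ B₁ := (norm_nonneg _).trans (hB₁ 0 (by simp))
  have hB₂0 : 0 ≤ B₂ := (norm_nonneg _).trans (hB₂ 0 (by simp))
  have hB₁' : ∀ t, |deriv smoothTransition t| ≤ B₁ := fun t => by
    by_cases ht : t ∈ Icc (0:ℝ) 1
    · exact hB₁ t ht
    · rw [deriv_smoothTransition_eq_zero fun h => ht (Ioo_subset_Icc_self h), abs_zero]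
      exact hB₁0
  have hB₂' : ∀ t, |deriv (deriv smoothTransition) t| ≤ B₂ := fun t => by
    by_cases ht : t ∈ Icc (0:ℝ) 1
    · exact hB₂ t ht
    · rw [deriv_deriv_smoothTransition_eq_zero fun h => ht (Ioo_subset_Icc_self h), abs_zero]
      exact hB₂0
  set Q : ℝ := 1 + φ (7 * π * B₁) + ψ (7 * π * B₂) with hQ
  refine ⟨4 + 2 * Q, by have := hφ0 (7 * π * B₁); have := hψ0 (7 * π * B₂); positivity, ?_⟩
  intro x₁ y₁ θ₁ hD
  set D := Real.sqrt (x₁ ^ 2 + y₁ ^ 2) with hDdef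
  obtain ⟨α₀, hα₀, hx₁, hy₁⟩ : ∃ α₀, |α₀| ≤ π ∧ D * cos α₀ = x₁ ∧ D * sin α₀ = y₁ := by
    have hn : ‖(⟨x₁, y₁⟩ : ℂ)‖ = D := by
      rw [hDdef, Complex.norm_eq_sqrt_sq_add_sq]
    refine ⟨Complex.arg ⟨x₁, y₁⟩, Complex.abs_arg_le_pi _, ?_, ?_⟩
    · rw [← hn]; exact Complex.norm_mul_cos_arg _
    · rw [← hn]; exact Complex.norm_mul_sin_arg _
  obtain ⟨k, hk⟩ : ∃ k : ℤ, θ₁ + 2 * π * k ∈ Ico 0 (2 * π) := by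
    refine ⟨-⌊θ₁ / (2 * π)⌋, ?_⟩
    have e1 := Int.floor_le (θ₁ / (2 * π))
    have e2 := Int.lt_floor_add_one (θ₁ / (2 * π))
    rw [le_div_iff₀ two_pi_pos] at e1
    rw [div_lt_iff₀ two_pi_pos] at e2
    push_cast
    constructor <;> nlinarith
  set β := θ₁ + 2 * π * k with hβ
  have hbound : ∀ (f g : ℝ → ℝ), (∀ r, |f r| ≤ 1) →
      |(∫ t in (0:ℝ)..1, f (g t))| ≤ 1 := by
    intro f g hf
    have := intervalIntegral.norm_integral_le_of_norm_le_const (a := (0:ℝ)) (b := 1) (C := 1)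
      (f := fun t => f (g t)) fun t _ => hf _
    simpa using this
  have hcont_st : Continuous smoothTransition := Real.smoothTransition.continuous
  have hcont : ∀ f : ℝ → ℝ, Continuous f → Continuous fun α =>
      (∫ t in (0:ℝ)..1, f (π / 2 + (α - π / 2) * smoothTransition t)) +
        ∫ t in (0:ℝ)..1, f (α + (β - α) * smoothTransition t) := by
    intro f hf
    refine Continuous.add ?_ ?_ <;>
    · refine intervalIntegral.continuous_parametric_intervalIntegral_of_continuous' ?_ 0 1
      refine hf.comp ?_
      fun_prop
  obtain ⟨α, hα, ℓ, hℓ, hℓD, hx, hy⟩ := exists_segment_direction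
    (hcont cos continuous_cos) (hcont sin continuous_sin)
    (fun α => (abs_add_le _ _).trans (by
      linarith [hbound cos (fun t => π / 2 + (α - π / 2) * smoothTransition t) abs_cos_le_one,
        hbound cos (fun t => α + (β - α) * smoothTransition t) abs_cos_le_one]))
    (fun α => (abs_add_le _ _).trans (by
      linarith [hbound sin (fun t => π / 2 + (α - π / 2) * smoothTransition t) abs_sin_le_one,
        hbound sin (fun t => α + (β - α) * smoothTransition t) abs_sin_le_one])) (α₀ := α₀) hD
  rw [hx₁, ← integral_turnHeading cos continuous_cos hℓ.le] at hx
  rw [hy₁, ← integral_turnHeading sin continuous_sin hℓ.le] at hy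
  have hθc := continuous_turnHeading α β ℓ
  have hκc := continuous_turnCurvature α β ℓ
  have huc := continuous_turnControl α β ℓ
  have hθ0 : turnHeading α β ℓ 0 = π / 2 := by
    rw [turnHeading, Real.smoothTransition.zero,
      Real.smoothTransition.zero_of_nonpos (by linarith : 0 - (1 + ℓ) ≤ 0)]
    ring
  have hκ0 : turnCurvature α β ℓ 0 = 0 := by
    rw [turnCurvature, deriv_smoothTransition_eq_zero (by simp),
      deriv_smoothTransition_eq_zero (fun h => by linarith [h.1])]
    ring
  have hθT : turnHeading α β ℓ (2 + ℓ) = β := by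
    rw [turnHeading, Real.smoothTransition.one_of_one_le (by linarith),
      Real.smoothTransition.one_of_one_le (by linarith)]
    ring
  have hκT : turnCurvature α β ℓ (2 + ℓ) = 0 := by
    rw [turnCurvature, deriv_smoothTransition_eq_zero (fun h => by linarith [h.2]),
      deriv_smoothTransition_eq_zero (fun h => by linarith [h.2])]
    ring
  refine ⟨fun t => ∫ s in (0:ℝ)..t, cos (turnHeading α β ℓ s),
    fun t => ∫ s in (0:ℝ)..t, sin (turnHeading α β ℓ s), turnHeading α β ℓ,
    turnCurvature α β ℓ, turnControl α β ℓ, 2 + ℓ, ?_, ?_⟩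
  · refine ⟨by linarith, huc.measurable, ?_, by simp [Xinit], by simp [Xinit], hθ0, hκ0,
      fun t _ => by simp, fun t _ => by simp, fun t _ => ?_, fun t _ => ?_, hx, hy,
      ⟨k, hθT⟩, hκT⟩
    · exact (huc.abs.rpow_const fun _ => Or.inr hp.le).continuousOn.integrableOn_Icc
    · rw [intervalIntegral.integral_eq_sub_of_hasDerivAt
        (fun s _ => hasDerivAt_turnHeading α β ℓ s) (hκc.intervalIntegrable _ _)]
      ring
    · rw [intervalIntegral.integral_eq_sub_of_hasDerivAt
        (fun s _ => hasDerivAt_turnCurvature α β ℓ s) (huc.intervalIntegrable _ _)]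
      ring
  · have hα1 : |α - π / 2| ≤ 3 * π := by
      have := abs_le.1 hα₀
      rw [abs_le]; constructor <;> linarith [hα.1, hα.2, this.1, this.2, pi_pos]
    have hα2 : |β - α| ≤ 4 * π := by
      have := abs_le.1 hα₀
      rw [abs_le]; constructor <;> linarith [hα.1, hα.2, this.1, this.2, hk.1, hk.2, pi_pos]
    have hκB : ∀ t, |turnCurvature α β ℓ t| ≤ 7 * π * B₁ := fun t => by
      calc _ ≤ |(α - π / 2) * deriv smoothTransition t| +
            |(β - α) * deriv smoothTransition (t - (1 + ℓ))| := abs_add_le _ _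
        _ ≤ 3 * π * B₁ + 4 * π * B₁ := by
          rw [abs_mul, abs_mul]
          have := hB₁' t
          have := hB₁' (t - (1 + ℓ))
          gcongr
        _ = 7 * π * B₁ := by ring
    have huB : ∀ t, |turnControl α β ℓ t| ≤ 7 * π * B₂ := fun t => by
      calc _ ≤ |(α - π / 2) * deriv (deriv smoothTransition) t| +
            |(β - α) * deriv (deriv smoothTransition) (t - (1 + ℓ))| :=
            abs_add_le _ _
        _ ≤ 3 * π * B₂ + 4 * π * B₂ := by
          rw [abs_mul, abs_mul]
          have := hB₂' t
          have := hB₂' (t - (1 + ℓ))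
          gcongr
        _ = 7 * π * B₂ := by ring
    have hc : Continuous fun t =>
        1 + φ (turnCurvature α β ℓ t) + ψ (turnControl α β ℓ t) :=
      (continuous_const.add (hφ2.continuous.comp hκc)).add (hψ2.continuous.comp huc)
    have hle : ∀ a b B : ℝ, a ≤ b →
        (∀ t ∈ Icc a b, 1 + φ (turnCurvature α β ℓ t) + ψ (turnControl α β ℓ t) ≤ B) →
        ∫ t in a..b, (1 + φ (turnCurvature α β ℓ t) + ψ (turnControl α β ℓ t)) ≤ (b - a) * B := by
      intro a b B hab hB
      calc _ ≤ ∫ t in a..b, B := intervalIntegral.integral_mono_on hab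
            (hc.intervalIntegrable _ _) intervalIntegrable_const hB
        _ = (b - a) * B := by rw [intervalIntegral.integral_const, smul_eq_mul]
    have hQle : ∀ t, 1 + φ (turnCurvature α β ℓ t) + ψ (turnControl α β ℓ t) ≤ Q := fun t => by
      have := even_monotone_le_of_abs_le hφe hφm (hκB t)
      have := even_monotone_le_of_abs_le hψe hψm (huB t)
      linarith
    have c1 := hle 0 1 Q zero_le_one fun t _ => hQle t
    have c2 := hle 1 (1 + ℓ) 1 (by linarith) fun t ht => by
      have n1 : t ∉ Ioo (0:ℝ) 1 := fun h => by linarith [h.2, ht.1]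
      have n2 : t - (1 + ℓ) ∉ Ioo (0:ℝ) 1 := fun h => by linarith [h.1, ht.2]
      rw [turnCurvature, turnControl, deriv_smoothTransition_eq_zero n1,
        deriv_smoothTransition_eq_zero n2, deriv_deriv_smoothTransition_eq_zero n1,
        deriv_deriv_smoothTransition_eq_zero n2]
      simp [hφz, hψz]
    have c3 := hle (1 + ℓ) (2 + ℓ) Q (by linarith) fun t _ => hQle t
    rw [cost, ← intervalIntegral.integral_add_adjacent_intervals
        (hc.intervalIntegrable 0 1) (hc.intervalIntegrable 1 (2 + ℓ)),
      ← intervalIntegral.integral_add_adjacent_intervals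
        (hc.intervalIntegrable 1 (1 + ℓ)) (hc.intervalIntegrable (1 + ℓ) (2 + ℓ))]
    linarith

/-- uniform `L^∞` bounds on `κ, p₃, p₄` and on `u` for optimal
trajectories with target far enough from the origin. -/
theorem uniform_bounds_far_target
    (φ ψ : ℝ → ℝ) (p C₀ R₀ : ℝ)
    (h1 : H1 φ ψ) (h2 : H2 ψ) (h3 : H3 ψ p C₀ R₀) :
    ∃ R > (0:ℝ), ∃ C > (0:ℝ),
      ∀ (x₁ y₁ θ₁ : ℝ), R ≤ Real.sqrt (x₁^2 + y₁^2) →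
      ∀ (x y θ κ u : ℝ → ℝ) (T ρ φh : ℝ) (p₃ p₄ : ℝ → ℝ),
        IsOptimal φ ψ p x y θ κ u T Xinit (x₁, y₁, θ₁, 0) →
        PMPData φ ψ θ κ u T ρ φh p₃ p₄ →
        (∀ t ∈ Set.Icc (0:ℝ) T, |κ t| ≤ C ∧ |p₃ t| ≤ C ∧ |p₄ t| ≤ C) ∧
        (∀ᵐ t ∂(volume.restrict (Set.Icc (0:ℝ) T)), |u t| ≤ C) := by
  obtain ⟨g, hg, hgr, hgl⟩ := exists_continuous_inverse_deriv h1 h2 h3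
  have hp : 1 < p := h3.1
  obtain ⟨K, hK, hcomp⟩ := exists_connects_cost_le h1 (zero_lt_one.trans hp)
  obtain ⟨c, hc, hlin⟩ := exists_abs_le_add_const h1.2.1 h3 1 zero_le_one
  set M : ℝ := 2 * (K + c * (K + 2)) + 4 with hM
  have hM0 : 0 ≤ M := by positivity
  obtain ⟨C, hC, hadj⟩ := exists_adjoint_bound h1 hg hgr M hM0
  refine ⟨5, by norm_num, M + C + 1, by positivity, ?_⟩
  rintro x₁ y₁ θ₁ hD x y θ κ u T ρ φh p₃ p₄ ⟨hcon, hopt⟩ ⟨hρ, -, hp₃, hp₄, hup, hham⟩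
  obtain ⟨hφ0, hψ0, hφ2, hψ2, -⟩ := h1
  obtain ⟨hT, hum, hup', hx0, hy0, -, hκ0, hx, hy, hθ, hκ, hxT, hyT, -, -⟩ := hcon
  have hTmem : T ∈ Icc (0:ℝ) T := ⟨hT.le, le_rfl⟩
  have hκ0' : κ 0 = 0 := hκ0
  -- regularity of the trajectory and of the adjoint variables
  have hui : IntegrableOn u (Icc 0 T) := by
    refine Integrable.mono' (g := fun t => 1 + |u t| ^ p)
      ((integrable_const 1).add hup') hum.aestronglyMeasurable (Filter.Eventually.of_forall ?_)
    intro t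
    rw [Real.norm_eq_abs]
    rcases le_total |u t| 1 with h | h
    · linarith [rpow_nonneg (abs_nonneg (u t)) p]
    · have := rpow_le_rpow_of_exponent_le h hp.le
      rw [rpow_one] at this
      linarith
  have hκc := continuousOn_of_eq_integral hT.le hui hκ
  have hθd := hasDerivWithinAt_of_eq_integral hκc hθ
  have hθc : ContinuousOn θ (Icc 0 T) := fun t ht => (hθd t ht).continuousWithinAt
  have hp₃d := hasDerivWithinAt_of_eq_integral
    (f := fun s => ρ * sin (θ s - φh)) (by fun_prop) hp₃
  have hp₃c : ContinuousOn p₃ (Icc 0 T) := fun t ht => (hp₃d t ht).continuousWithinAt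
  have hdφ : Continuous (deriv φ) := hφ2.continuous_deriv (by norm_num)
  have hp₄d := hasDerivWithinAt_of_eq_integral
    (f := fun s => -(p₃ s) + deriv φ (κ s)) (hp₃c.neg.add (hdφ.comp_continuousOn hκc)) hp₄
  have hp₄c : ContinuousOn p₄ (Icc 0 T) := fun t ht => (hp₄d t ht).continuousWithinAt
  -- the control has a continuous representative
  have huv : ∀ᵐ t ∂(volume.restrict (Icc (0:ℝ) T)), u t = g (p₄ t) := by
    filter_upwards [hup] with t ht
    rw [← ht, hgl]
  have hvc : ContinuousOn (fun t => g (p₄ t)) (Icc 0 T) := hg.comp_continuousOn hp₄c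
  have hκd := hasDerivWithinAt_of_eq_integral (F := κ) hvc fun t ht => by
    rw [hκ t ht]
    congr 1
    refine intervalIntegral.integral_congr_ae_restrict ?_
    rw [uIoc_of_le ht.1]
    exact ae_restrict_of_ae_restrict_of_subset
      (Ioc_subset_Icc_self.trans (Icc_subset_Icc_right ht.2)) huv
  have hφκc : ContinuousOn (fun t => φ (κ t)) (Icc 0 T) := hφ2.continuous.comp_continuousOn hκc
  have hψvc : ContinuousOn (fun t => ψ (g (p₄ t))) (Icc 0 T) :=
    hψ2.continuous.comp_continuousOn hvc
  have hham' : ∀ t ∈ Icc (0:ℝ) T, ρ * cos (θ t - φh) + p₃ t * κ t + p₄ t * g (p₄ t)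
      - (1 + φ (κ t) + ψ (g (p₄ t))) = 0 := by
    have hae : (fun t => ρ * cos (θ t - φh) + p₃ t * κ t + p₄ t * g (p₄ t)
        - (1 + φ (κ t) + ψ (g (p₄ t)))) =ᵐ[volume.restrict (Icc (0:ℝ) T)] fun _ => (0:ℝ) := by
      filter_upwards [hham, huv] with t h h'
      rwa [h'] at h
    exact fun t ht => MeasureTheory.Measure.eqOn_Icc_of_ae_eq volume hT.ne hae
      (((((continuous_cos.comp_continuousOn (hθc.sub continuousOn_const)).const_mul ρ).add
        (hp₃c.mul hκc)).add (hp₄c.mul hvc)).sub ((continuousOn_const.add hφκc).add hψvc))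
      continuousOn_const ht
  -- consequences of optimality
  set D := Real.sqrt (x₁ ^ 2 + y₁ ^ 2) with hDdef
  have hint : ∀ (f : ℝ → ℝ), ContinuousOn f (Icc 0 T) → ∀ a b, 0 ≤ a → a ≤ b → b ≤ T →
      IntervalIntegrable f volume a b := fun f hf a b ha hab hb =>
    ContinuousOn.intervalIntegrable (by
      rw [uIcc_of_le hab]; exact hf.mono (Icc_subset_Icc ha hb))
  have hcost : cost φ ψ κ u T = T + (∫ t in (0:ℝ)..T, φ (κ t)) + ∫ t in (0:ℝ)..T, ψ (g (p₄ t)) := by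
    have e : cost φ ψ κ u T = ∫ t in (0:ℝ)..T, (1 + φ (κ t) + ψ (g (p₄ t))) := by
      refine intervalIntegral.integral_congr_ae_restrict ?_
      rw [uIoc_of_le hT.le]
      filter_upwards [ae_restrict_of_ae_restrict_of_subset Ioc_subset_Icc_self huv] with t ht
      rw [ht]
    have i2 := hint _ hφκc 0 T le_rfl hT.le le_rfl
    have i3 := hint _ hψvc 0 T le_rfl hT.le le_rfl
    rw [e, intervalIntegral.integral_add (intervalIntegrable_const.add i2) i3,
      intervalIntegral.integral_add intervalIntegrable_const i2]
    simp
  have hcostD : cost φ ψ κ u T ≤ D + K := by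
    obtain ⟨x', y', θ', κ', u', T', hcon', hle⟩ := hcomp x₁ y₁ θ₁ hD
    exact (hopt _ _ _ _ _ _ hcon').trans hle
  have hφint : 0 ≤ ∫ t in (0:ℝ)..T, φ (κ t) :=
    intervalIntegral.integral_nonneg hT.le fun t _ => hφ0 _
  have hψint : 0 ≤ ∫ t in (0:ℝ)..T, ψ (g (p₄ t)) :=
    intervalIntegral.integral_nonneg hT.le fun t _ => hψ0 _
  obtain ⟨α, hα⟩ : ∃ α, ∫ s in (0:ℝ)..T, cos (θ s - α) = D := by
    have hn : ‖(⟨x₁, y₁⟩ : ℂ)‖ = D := by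
      rw [hDdef, Complex.norm_eq_sqrt_sq_add_sq]
    have k1 := Complex.norm_mul_cos_arg ⟨x₁, y₁⟩
    have k2 := Complex.norm_mul_sin_arg ⟨x₁, y₁⟩
    rw [hn] at k1 k2
    simp only at k1 k2
    set α := Complex.arg ⟨x₁, y₁⟩
    refine ⟨α, ?_⟩
    have ex := hx T hTmem
    have ey := hy T hTmem
    rw [hxT, hx0] at ex
    rw [hyT, hy0] at ey
    simp only [Xinit, zero_add] at ex ey
    simp only [cos_sub]
    rw [intervalIntegral.integral_add
        (hint _ (by fun_prop) 0 T le_rfl hT.le le_rfl)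
        (hint _ (by fun_prop) 0 T le_rfl hT.le le_rfl),
      intervalIntegral.integral_mul_const, intervalIntegral.integral_mul_const, ← ex, ← ey,
      ← k1, ← k2]
    linear_combination D * sin_sq_add_cos_sq α
  have hDT : D ≤ T := by
    rw [← hα]
    calc _ ≤ ∫ s in (0:ℝ)..T, (1:ℝ) := intervalIntegral.integral_mono_on hT.le
          (hint _ (by fun_prop) 0 T le_rfl hT.le le_rfl)
          intervalIntegrable_const fun s _ => cos_le_one _
      _ = T := by simp
  have hvarc : ∀ a b, 0 ≤ a → a ≤ b → b ≤ T → ∫ s in a..b, |g (p₄ s)| ≤ K + c * (b - a) := by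
    intro a b ha hab hb
    calc ∫ s in a..b, |g (p₄ s)| ≤ ∫ s in a..b, (ψ (g (p₄ s)) + c) := by
          refine intervalIntegral.integral_mono_on hab (hint _ hvc.abs a b ha hab hb)
            ((hint _ hψvc a b ha hab hb).add intervalIntegrable_const) fun s _ => ?_
          have := hlin (g (p₄ s))
          linarith
      _ = (∫ s in a..b, ψ (g (p₄ s))) + c * (b - a) := by
          rw [intervalIntegral.integral_add (hint _ hψvc a b ha hab hb) intervalIntegrable_const,
            intervalIntegral.integral_const, smul_eq_mul, mul_comm c]
      _ ≤ K + c * (b - a) := by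
          have : ∫ s in a..b, ψ (g (p₄ s)) ≤ ∫ s in (0:ℝ)..T, ψ (g (p₄ s)) :=
            intervalIntegral.integral_mono_interval ha hab hb
              (Filter.Eventually.of_forall fun s => hψ0 _)
              (hint _ hψvc 0 T le_rfl hT.le le_rfl)
          linarith
  have hκM := abs_curvature_le hK hc hθd hκd hvc hκ0' hvarc (α := α) (by rw [hα]; linarith)
  have hbounds := hadj θ κ p₃ p₄ T ρ φh (by linarith) hρ hκM hθd hκd hp₃d hp₄d hham'
  refine ⟨fun t ht => ?_, ?_⟩
  · obtain ⟨b1, b2, -⟩ := hbounds t ht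
    have b0 := hκM t ht
    exact ⟨by linarith, by linarith, by linarith⟩
  · filter_upwards [huv, ae_restrict_mem measurableSet_Icc] with t h ht
    rw [h]
    linarith [(hbounds t ht).2.2]

end
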